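/- arXiv:math-ph/0112025 — 2 statements merged into one kernel-verified Lean document; each statement's English description precedes it below -/
import Mathlib

section
/- Fix an integer N ≥ 2, a positive integer m, set ℓ = (N−1)m, and let ℏ be a nonzero complex number. Let {H_{ε₁,…,ε_ℓ}(α₁,…,α_ℓ)} be a family of rational functions, indexed by tuples ε with entries in {0,…,N−2} satisfying #{a : ε_a ≥ j} = (N−1−j)m for j = 1,…,N−2, that satisfies the exchange relation (rel1) and the normalization (rel3). Then for every index tuple ε, the rational function ∏_{1≤a<b≤ℓ}(α_a−α_b−ℏ) · H_{ε₁,…,ε_ℓ}(α₁,…,α_ℓ) is a polynomial in α₁,…,α_ℓ whose degree in each single variable α_a is at most m−1. -/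
open MvPolynomial Finset

noncomputable section

/-- The field `ℂ(α₁,…,α_ℓ)` of rational functions in `ℓ` variables, realized as the
fraction field of the polynomial ring `ℂ[α₁,…,α_ℓ]`. -/
abbrev RF (ℓ : ℕ) : Type := FractionRing (MvPolynomial (Fin ℓ) ℂ)

/-- Lift an injective substitution of the polynomial ring to the field of rational
functions. -/
noncomputable def liftRF {ℓ ℓ' : ℕ} (f : MvPolynomial (Fin ℓ) ℂ →+* MvPolynomial (Fin ℓ') ℂ)
    (hf : Function.Injective f) : RF ℓ →+* RF ℓ' :=
  IsFractionRing.lift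
    (g := (algebraMap (MvPolynomial (Fin ℓ') ℂ) (RF ℓ')).comp f)
    (fun _ _ hab => hf (IsFractionRing.injective (MvPolynomial (Fin ℓ') ℂ) (RF ℓ') hab))

/-- The action of a permutation `σ` of the variables on rational functions:
`(permRF σ F)(α₁,…,α_ℓ) = F(α_{σ(1)},…,α_{σ(ℓ)})`. -/
noncomputable def permRF {ℓ : ℕ} (σ : Equiv.Perm (Fin ℓ)) : RF ℓ →+* RF ℓ :=
  liftRF (MvPolynomial.renameEquiv ℂ σ).toAlgHom.toRingHom (MvPolynomial.renameEquiv ℂ σ).injective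

/-- The substitution `α_t ↦ α_t + c` as an algebra automorphism of `ℂ[α₁,…,α_ℓ]`. -/
noncomputable def shiftAlgEquiv {ℓ : ℕ} (t : Fin ℓ) (c : ℂ) :
    MvPolynomial (Fin ℓ) ℂ ≃ₐ[ℂ] MvPolynomial (Fin ℓ) ℂ :=
  AlgEquiv.ofAlgHom
    (aeval fun i => if i = t then X i + C c else X i)
    (aeval fun i => if i = t then X i - C c else X i)
    (by
      apply MvPolynomial.algHom_ext; intro i
      by_cases h : i = t <;> simp [h])
    (by
      apply MvPolynomial.algHom_ext; intro i
      by_cases h : i = t <;> simp [h])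

/-- The substitution `α_t ↦ α_t + c` acting on rational functions. -/
noncomputable def shiftRF {ℓ : ℕ} (t : Fin ℓ) (c : ℂ) : RF ℓ →+* RF ℓ :=
  liftRF (shiftAlgEquiv t c).toAlgHom.toRingHom (shiftAlgEquiv t c).injective

/-- The coordinate function `α_a` as a rational function. -/
noncomputable def XX {ℓ : ℕ} (a : Fin ℓ) : RF ℓ :=
  algebraMap (MvPolynomial (Fin ℓ) ℂ) (RF ℓ) (X a)

/-- A constant as a rational function. -/
noncomputable def CC {ℓ : ℕ} (z : ℂ) : RF ℓ :=
  algebraMap (MvPolynomial (Fin ℓ) ℂ) (RF ℓ) (C z)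

/-- `ε = (ε₁,…,ε_ℓ)` is an admissible index tuple: its entries lie in `{0,…,N−2}` and
`#{a : ε_a ≥ j} = (N−1−j)·m` for `j = 1,…,N−2`. -/
def IsIdx (N m ℓ : ℕ) (ε : Fin ℓ → ℕ) : Prop :=
  (∀ a, ε a ≤ N - 2) ∧
    ∀ j, 1 ≤ j → j ≤ N - 2 →
      (Finset.univ.filter fun a => j ≤ ε a).card = (N - 1 - j) * m

/-- The type of admissible index tuples. -/
abbrev IdxT (N m ℓ : ℕ) := {ε : Fin ℓ → ℕ // IsIdx N m ℓ ε}

/-- Relation (i) = (rel1), the exchange relation: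
`H_{…,ε_{p+1},ε_p,…}(…,α_{p+1},α_p,…) = (α_p−α_{p+1})/(α_p−α_{p+1}+ℏ)·H_{…,ε_p,ε_{p+1},…}(…,α_p,α_{p+1},…) + ℏ/(α_p−α_{p+1}+ℏ)·H_{…,ε_{p+1},ε_p,…}(…,α_p,α_{p+1},…)`.
Here `ε'` is `ε` with its `p`-th and `(p+1)`-st entries interchanged, and applying
`permRF (swap p q)` interchanges the `p`-th and `(p+1)`-st arguments. -/
def HRel1 (N m ℓ : ℕ) (ℏ : ℂ) (H : IdxT N m ℓ → RF ℓ) : Prop :=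
  ∀ (ε ε' : IdxT N m ℓ) (p q : Fin ℓ),
    (q : ℕ) = (p : ℕ) + 1 → ε'.1 = ε.1 ∘ Equiv.swap p q →
    permRF (Equiv.swap p q) (H ε') =
      (XX p - XX q) / (XX p - XX q + CC ℏ) * H ε + CC ℏ / (XX p - XX q + CC ℏ) * H ε'

/-- Relation (ii) = (rel2), the shift relation:
`H_{ε₁,…,ε_ℓ}(α₁,…,α_{ℓ−1},α_ℓ−Nℏ) = ∏_{a=1}^{ℓ−1}(α_a−α_ℓ+ℏ)/(α_a−α_ℓ+(N−1)ℏ) · H_{ε_ℓ,ε₁,…,ε_{ℓ−1}}(α_ℓ,α₁,…,α_{ℓ−1})`.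
Here `t` is the last index, `ε' = ε ∘ (finRotate ℓ).symm = (ε_ℓ,ε₁,…,ε_{ℓ−1})`, and
`permRF (finRotate ℓ).symm` cyclically permutes the arguments to `(α_ℓ,α₁,…,α_{ℓ−1})`. -/
def HRel2 (N m ℓ : ℕ) (ℏ : ℂ) (H : IdxT N m ℓ → RF ℓ) : Prop :=
  ∀ (ε ε' : IdxT N m ℓ) (t : Fin ℓ), (t : ℕ) = ℓ - 1 →
    ε'.1 = ε.1 ∘ (finRotate ℓ).symm →
    shiftRF t (-((N : ℂ) * ℏ)) (H ε) =
      (∏ a ∈ Finset.univ.erase t,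
        ((XX a - XX t + CC ℏ) / (XX a - XX t + CC (((N : ℂ) - 1) * ℏ)))) *
        permRF (finRotate ℓ).symm (H ε')

/-- Relation (iii) = (rel3), the normalization: for the increasing index tuple
`ε = (0^m,1^m,…,(N−2)^m)` (i.e. `ε_a = ⌊a/m⌋`),
`H_ε = ∏_{(a,b) : ε_a<ε_b} 1/(α_a−α_b−ℏ)`, the product over all ordered pairs `(a,b)`
with `ε_a < ε_b`. -/
def HRel3 (N m ℓ : ℕ) (ℏ : ℂ) (H : IdxT N m ℓ → RF ℓ) : Prop :=
  ∀ ε : IdxT N m ℓ, ε.1 = (fun a : Fin ℓ => (a : ℕ) / m) →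
    H ε = ∏ ab ∈ Finset.univ.filter
        (fun ab : Fin ℓ × Fin ℓ => (ab.1 : ℕ) / m < (ab.2 : ℕ) / m),
      (XX ab.1 - XX ab.2 - CC ℏ)⁻¹

theorem permRF_algebraMap {ℓ : ℕ} (σ : Equiv.Perm (Fin ℓ)) (P : MvPolynomial (Fin ℓ) ℂ) :
    permRF σ (algebraMap _ (RF ℓ) P) = algebraMap _ (RF ℓ) (rename σ P) := by
  exact IsFractionRing.lift_algebraMap (fun _ _ hab => (renameEquiv ℂ σ).injective
    (IsFractionRing.injective (MvPolynomial (Fin ℓ) ℂ) (RF ℓ) hab)) P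

/-- The difference `P - σP`, for `σ` the transposition of two variables, is divisible by the
difference of these variables. -/
theorem X_sub_X_dvd_sub_rename_swap {ι R : Type*} [DecidableEq ι] [CommRing R] (p q : ι)
    (P : MvPolynomial ι R) :
    (X p - X q : MvPolynomial ι R) ∣ P - rename (Equiv.swap p q) P := by
  induction P using MvPolynomial.induction_on with
  | C a => simp
  | add f g hf hg =>
    rw [map_add, add_sub_add_comm]
    exact dvd_add hf hg
  | mul_X f i hf =>
    have hX : (X p - X q : MvPolynomial ι R) ∣ X i - X (Equiv.swap p q i) := by
      rcases eq_or_ne i p with rfl | hp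
      · simp
      rcases eq_or_ne i q with rfl | hq
      · rw [Equiv.swap_apply_right, ← dvd_neg, neg_sub]
      · simp [Equiv.swap_apply_of_ne_of_ne hp hq]
    rw [map_mul, rename_X, show f * X i - rename (Equiv.swap p q) f * X (Equiv.swap p q i) =
      (f - rename (Equiv.swap p q) f) * X i +
        rename (Equiv.swap p q) f * (X i - X (Equiv.swap p q i)) by ring]
    exact dvd_add (hf.mul_right _) (hX.mul_left _)

theorem degreeOf_rename_swap_le {ι R : Type*} [DecidableEq ι] [CommSemiring R] (p q : ι) {d : ℕ}
    {P : MvPolynomial ι R} (hP : ∀ a, P.degreeOf a ≤ d) (a : ι) :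
    (rename (Equiv.swap p q) P).degreeOf a ≤ d := by
  have h := degreeOf_rename_of_injective (p := P) (Equiv.swap p q).injective (Equiv.swap p q a)
  rw [Equiv.swap_apply_self] at h
  exact h ▸ hP _

/-- The divided difference of a polynomial in two variables does not raise the bound on the
degrees in the single variables. -/
theorem exists_dividedDifference {ι R : Type*} [DecidableEq ι] [CommRing R] [IsDomain R]
    {p q : ι} (hpq : p ≠ q) {d : ℕ} {P : MvPolynomial ι R} (hP : ∀ a, P.degreeOf a ≤ d) :
    ∃ Q : MvPolynomial ι R, (∀ a, Q.degreeOf a ≤ d) ∧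
      P - rename (Equiv.swap p q) P = (X p - X q) * Q := by
  obtain ⟨Q, hQ⟩ := X_sub_X_dvd_sub_rename_swap p q P
  refine ⟨Q, fun a => ?_, hQ⟩
  rcases eq_or_ne Q 0 with rfl | hQ0
  · simp
  have hX : (X p - X q : MvPolynomial ι R) ≠ 0 := sub_ne_zero.mpr fun h => hpq (X_injective h)
  calc Q.degreeOf a ≤ ((X p - X q) * Q).degreeOf a := by
        rw [degreeOf_mul_eq hX hQ0]
        exact Nat.le_add_left _ _
    _ = (P - rename (Equiv.swap p q) P).degreeOf a := by rw [hQ]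
    _ ≤ d := (degreeOf_sub_le _ _ _).trans (max_le (hP a) (degreeOf_rename_swap_le p q hP a))

/-- The product `∏_{a<b}(α_a−α_b−ℏ)`. -/
def quantumVandermonde (ℓ : ℕ) (ℏ : ℂ) : MvPolynomial (Fin ℓ) ℂ :=
  ∏ ab ∈ Finset.univ.filter (fun ab : Fin ℓ × Fin ℓ => ab.1 < ab.2), (X ab.1 - X ab.2 - C ℏ)

theorem algebraMap_quantumVandermonde (ℓ : ℕ) (ℏ : ℂ) :
    algebraMap _ (RF ℓ) (quantumVandermonde ℓ ℏ) =
      ∏ ab ∈ Finset.univ.filter (fun ab : Fin ℓ × Fin ℓ => ab.1 < ab.2),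
        (XX ab.1 - XX ab.2 - CC ℏ) := by
  simp [quantumVandermonde, XX, CC, map_prod]

theorem swap_lt_swap_of_consecutive {ℓ : ℕ} {p q : Fin ℓ} (hpq : (q : ℕ) = p + 1) {a b : Fin ℓ}
    (hab : a < b) (hne : (a, b) ≠ (p, q)) : Equiv.swap p q a < Equiv.swap p q b := by
  simp only [ne_eq, Prod.mk.injEq, not_and] at hne
  rw [Equiv.swap_apply_def, Equiv.swap_apply_def]
  split_ifs <;> simp only [Fin.ext_iff, Fin.lt_def] at * <;> omega

/-- Transposing neighbouring variables multiplies `∏_{a<b}(α_a−α_b−ℏ)` by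
`(α_q−α_p−ℏ)/(α_p−α_q−ℏ)`. -/
theorem rename_swap_quantumVandermonde {ℓ : ℕ} (ℏ : ℂ) {p q : Fin ℓ} (hpq : (q : ℕ) = p + 1) :
    (X p - X q - C ℏ) * rename (Equiv.swap p q) (quantumVandermonde ℓ ℏ) =
      (X q - X p - C ℏ) * quantumVandermonde ℓ ℏ := by
  have hlt : p < q := Fin.lt_def.mpr (by omega)
  have hmem : (p, q) ∈ Finset.univ.filter (fun ab : Fin ℓ × Fin ℓ => ab.1 < ab.2) := by
    simpa using hlt
  have hmaps : ∀ ab ∈ (Finset.univ.filter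
      (fun ab : Fin ℓ × Fin ℓ => ab.1 < ab.2)).erase (p, q),
      (Equiv.swap p q ab.1, Equiv.swap p q ab.2) ∈
        (Finset.univ.filter (fun ab : Fin ℓ × Fin ℓ => ab.1 < ab.2)).erase (p, q) := by
    rintro ⟨a, b⟩ hab
    simp only [mem_erase, mem_filter, mem_univ, true_and] at hab ⊢
    refine ⟨fun h => ?_, swap_lt_swap_of_consecutive hpq hab.2 hab.1⟩
    simp only [Prod.mk.injEq, Equiv.swap_apply_eq_iff, Equiv.swap_apply_left,
      Equiv.swap_apply_right] at h
    exact absurd hab.2 (by rw [h.1, h.2]; exact hlt.asymm)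
  have hprod : ∏ ab ∈ (Finset.univ.filter
      (fun ab : Fin ℓ × Fin ℓ => ab.1 < ab.2)).erase (p, q),
        (X (Equiv.swap p q ab.1) - X (Equiv.swap p q ab.2) - C ℏ : MvPolynomial (Fin ℓ) ℂ) =
      ∏ ab ∈ (Finset.univ.filter (fun ab : Fin ℓ × Fin ℓ => ab.1 < ab.2)).erase (p, q),
        (X ab.1 - X ab.2 - C ℏ) :=
    Finset.prod_nbij' (fun ab => (Equiv.swap p q ab.1, Equiv.swap p q ab.2))
      (fun ab => (Equiv.swap p q ab.1, Equiv.swap p q ab.2)) hmaps hmaps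
      (by simp) (by simp) (by simp)
  simp only [quantumVandermonde, map_prod, map_sub, rename_X, rename_C]
  rw [← Finset.mul_prod_erase _ _ hmem, ← Finset.mul_prod_erase _ _ hmem, hprod]
  simp only [Equiv.swap_apply_left, Equiv.swap_apply_right]
  ring

theorem X_sub_X_add_C_ne_zero {ι R : Type*} [CommRing R] [Nontrivial R] {p q : ι} (hpq : p ≠ q)
    (c : R) : (X p - X q + C c : MvPolynomial ι R) ≠ 0 := by
  classical
  intro h
  have h' := congrArg (aeval fun i => if i = p then 1 - c else 0) h
  simp [hpq.symm] at h'

theorem X_sub_X_sub_C_ne_zero {ι R : Type*} [CommRing R] [Nontrivial R] {p q : ι} (hpq : p ≠ q)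
    (c : R) : (X p - X q - C c : MvPolynomial ι R) ≠ 0 := by
  simpa [sub_eq_add_neg] using X_sub_X_add_C_ne_zero hpq (-c)

/-- A property of tuples holding for monotone ones and preserved by transpositions of
neighbouring entries holds for all tuples. -/
theorem tuple_induction_of_monotone {α : Type*} [LinearOrder α] {ℓ : ℕ}
    {motive : (Fin ℓ → α) → Prop} (mono : ∀ ε, Monotone ε → motive ε)
    (swap : ∀ ε (p q : Fin ℓ), (q : ℕ) = p + 1 → motive ε → motive (ε ∘ Equiv.swap p q))
    (ε : Fin ℓ → α) : motive ε := by
  cases ℓ with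
  | zero => exact mono ε (Subsingleton.monotone ε)
  | succ n =>
    have key : ∀ σ : Equiv.Perm (Fin (n + 1)), motive ((ε ∘ Tuple.sort ε) ∘ σ) := by
      intro σ
      have hσ : σ ∈ Submonoid.closure
          (Set.range fun i : Fin n => Equiv.swap i.castSucc i.succ) := by
        rw [Equiv.Perm.mclosure_swap_castSucc_succ]
        trivial
      induction hσ using Submonoid.closure_induction_right with
      | one => exact mono _ (Tuple.monotone_sort ε)
      | mul_right x _ y hy ih =>
        obtain ⟨i, rfl⟩ := hy
        exact swap _ i.castSucc i.succ (by simp) ih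
    simpa [Function.comp_def] using key (Tuple.sort ε)⁻¹

theorem Monotone.le_apply_iff_of_card {α : Type*} [LinearOrder α] {ℓ c : ℕ} {ε : Fin ℓ → α}
    (hε : Monotone ε) {j : α}
    (hc : (Finset.univ.filter fun a => j ≤ ε a).card + c = ℓ) (a : Fin ℓ) :
    j ≤ ε a ↔ c ≤ (a : ℕ) := by
  have ha := a.isLt
  constructor
  · intro h
    have hsub : Finset.Ici a ⊆ Finset.univ.filter fun b => j ≤ ε b := fun b hb => by
      simpa using h.trans (hε (Finset.mem_Ici.mp hb))
    have := Finset.card_le_card hsub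
    rw [Fin.card_Ici] at this
    omega
  · intro h
    by_contra hlt
    have hsub : (Finset.univ.filter fun b => j ≤ ε b) ⊆ Finset.Ioi a := fun b hb => by
      rw [Finset.mem_Ioi]
      by_contra hba
      exact hlt ((Finset.mem_filter.mp hb).2.trans (hε (not_lt.mp hba)))
    have := Finset.card_le_card hsub
    rw [Fin.card_Ioi] at this
    omega

theorem IsIdx.comp_perm {N m ℓ : ℕ} {ε : Fin ℓ → ℕ} (h : IsIdx N m ℓ ε)
    (σ : Equiv.Perm (Fin ℓ)) : IsIdx N m ℓ (ε ∘ σ) := by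
  refine ⟨fun a => h.1 _, fun j hj hj' => ?_⟩
  rw [← h.2 j hj hj']
  exact Finset.card_equiv σ (by simp)

/-- The only monotone admissible index tuple is `(0^m,1^m,…,(N−2)^m)`. -/
theorem IsIdx.eq_div_of_monotone {N m : ℕ} (hN : 2 ≤ N) (hm : 1 ≤ m)
    {ε : Fin ((N - 1) * m) → ℕ} (h : IsIdx N m ((N - 1) * m) ε) (hε : Monotone ε) :
    ε = fun a : Fin ((N - 1) * m) => (a : ℕ) / m := by
  funext a
  refine eq_of_forall_le_iff fun j => ?_
  rw [Nat.le_div_iff_mul_le hm]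
  rcases Nat.eq_zero_or_pos j with rfl | hj
  · simp
  rcases le_or_gt j (N - 2) with hj' | hj'
  · refine hε.le_apply_iff_of_card ?_ a
    rw [h.2 j hj hj', ← add_mul, Nat.sub_add_cancel (by omega)]
  · have h1 := h.1 a
    have h2 : (N - 1) * m ≤ j * m := Nat.mul_le_mul_right m (by omega)
    have h3 := a.isLt
    constructor <;> intro <;> omega

/-- The part of `∏_{a<b}(α_a−α_b−ℏ)` coming from pairs in a common block of length `m`. -/
def blockVandermonde (ℓ m : ℕ) (ℏ : ℂ) : MvPolynomial (Fin ℓ) ℂ :=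
  ∏ ab ∈ Finset.univ.filter
    (fun ab : Fin ℓ × Fin ℓ => ab.1 < ab.2 ∧ (ab.1 : ℕ) / m = (ab.2 : ℕ) / m),
      (X ab.1 - X ab.2 - C ℏ)

theorem blockVandermonde_mul (ℓ m : ℕ) (ℏ : ℂ) :
    blockVandermonde ℓ m ℏ * (∏ ab ∈ Finset.univ.filter
        (fun ab : Fin ℓ × Fin ℓ => (ab.1 : ℕ) / m < (ab.2 : ℕ) / m), (X ab.1 - X ab.2 - C ℏ)) =
      quantumVandermonde ℓ ℏ := by
  rw [blockVandermonde, quantumVandermonde, ← Finset.prod_union]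
  · congr 1
    ext ⟨a, b⟩
    simp only [mem_union, mem_filter, mem_univ, true_and, Fin.lt_def]
    constructor
    · rintro (h | h)
      · exact h.1
      · exact lt_of_not_ge fun hba => h.not_ge (Nat.div_le_div_right hba)
    · intro h
      rcases (Nat.div_le_div_right (c := m) h.le).eq_or_lt with h' | h'
      · exact Or.inl ⟨h, h'⟩
      · exact Or.inr h'
  · rw [Finset.disjoint_filter]
    rintro ab - ⟨-, h⟩ h'
    exact h'.ne h

theorem degreeOf_blockVandermonde_le (ℓ : ℕ) {m : ℕ} (hm : 1 ≤ m) (ℏ : ℂ) (a : Fin ℓ) :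
    (blockVandermonde ℓ m ℏ).degreeOf a ≤ m - 1 := by
  set S := Finset.univ.filter
    (fun ab : Fin ℓ × Fin ℓ => ab.1 < ab.2 ∧ (ab.1 : ℕ) / m = (ab.2 : ℕ) / m) with hS
  set B := (Finset.Ico (m * (a / m)) (m * (a / m) + m)).erase (a : ℕ) with hB
  have hdeg : ∀ ab : Fin ℓ × Fin ℓ,
      (X ab.1 - X ab.2 - C ℏ : MvPolynomial (Fin ℓ) ℂ).degreeOf a ≤
        if a = ab.1 ∨ a = ab.2 then 1 else 0 := by
    intro ab
    refine (degreeOf_sub_le _ _ _).trans (max_le ((degreeOf_sub_le _ _ _).trans ?_) ?_)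
    · rw [degreeOf_X, degreeOf_X]
      split_ifs <;> simp_all
    · simp
  have hmod : m * ((a : ℕ) / m) ≤ a ∧ (a : ℕ) < m * (a / m) + m := by
    have h1 := Nat.div_add_mod (a : ℕ) m
    have h2 := Nat.mod_lt (a : ℕ) hm
    omega
  calc (blockVandermonde ℓ m ℏ).degreeOf a
      ≤ ∑ ab ∈ S, (X ab.1 - X ab.2 - C ℏ : MvPolynomial (Fin ℓ) ℂ).degreeOf a :=
        degreeOf_prod_le _ _ _
    _ ≤ ∑ ab ∈ S, if a = ab.1 ∨ a = ab.2 then 1 else 0 := Finset.sum_le_sum fun ab _ => hdeg ab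
    _ = (S.filter fun ab => a = ab.1 ∨ a = ab.2).card := by rw [Finset.card_filter]
    _ ≤ B.card := by
        refine Finset.card_le_card_of_injOn (fun ab => (ab.1 + ab.2 - a : ℕ)) ?_ ?_
        · rintro ⟨b, c⟩ h
          simp only [hS, coe_filter, mem_filter, mem_univ, true_and, Set.mem_ofPred_eq,
            Fin.lt_def] at h
          obtain ⟨⟨hlt, hdiv⟩, hor⟩ := h
          have hb1 := Nat.div_add_mod (b : ℕ) m
          have hb2 := Nat.mod_lt (b : ℕ) hm
          have hc1 := Nat.div_add_mod (c : ℕ) m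
          have hc2 := Nat.mod_lt (c : ℕ) hm
          simp only [hB, coe_erase, Finset.coe_Ico, Set.mem_sdiff, Set.mem_Ico,
            Set.mem_singleton_iff]
          rcases hor with rfl | rfl
          · rw [hdiv] at hb1 ⊢
            omega
          · rw [hdiv] at hb1
            omega
        · rintro ⟨b, c⟩ h ⟨b', c'⟩ h' heq
          simp only [hS, coe_filter, mem_filter, mem_univ, true_and, Set.mem_ofPred_eq,
            Fin.lt_def] at h h'
          simp only [Prod.mk.injEq, Fin.ext_iff] at *
          omega
    _ = m - 1 := by
        rw [hB, Finset.card_erase_of_mem (by simpa using hmod), Nat.card_Ico]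
        omega

/-- The exchange relation, rewritten for `P_ε = ∏_{a<b}(α_a−α_b−ℏ)·H_ε`, preserves
polynomiality and bounds on the degrees in the single variables. -/
theorem HRel1.exists_polynomial_swap {N m ℓ : ℕ} {ℏ : ℂ} {H : IdxT N m ℓ → RF ℓ}
    (h1 : HRel1 N m ℓ ℏ H) {ε ε' : IdxT N m ℓ} {p q : Fin ℓ} (hpq : (q : ℕ) = p + 1)
    (hε : ε'.1 = ε.1 ∘ Equiv.swap p q) {d : ℕ} {P : MvPolynomial (Fin ℓ) ℂ}
    (hdeg : ∀ a, P.degreeOf a ≤ d)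
    (hP : algebraMap _ (RF ℓ) (quantumVandermonde ℓ ℏ) * H ε' = algebraMap _ (RF ℓ) P) :
    ∃ R : MvPolynomial (Fin ℓ) ℂ, (∀ a, R.degreeOf a ≤ d) ∧
      algebraMap _ (RF ℓ) (quantumVandermonde ℓ ℏ) * H ε = algebraMap _ (RF ℓ) R := by
  have hne : p ≠ q := fun h => by rw [h] at hpq; omega
  obtain ⟨Q, hQ, hPQ⟩ := exists_dividedDifference hne hdeg
  refine ⟨-(rename (Equiv.swap p q) P + C ℏ * Q), fun a => ?_, ?_⟩
  · rw [degreeOf_neg]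
    exact (degreeOf_add_le _ _ _).trans (max_le (degreeOf_rename_swap_le p q hdeg a)
      ((degreeOf_C_mul_le _ _ _).trans (hQ a)))
  have hinj := IsFractionRing.injective (MvPolynomial (Fin ℓ) ℂ) (RF ℓ)
  have hadd : (XX p - XX q + CC ℏ : RF ℓ) ≠ 0 := by
    simpa [XX, CC] using (map_ne_zero_iff _ hinj).mpr (X_sub_X_add_C_ne_zero hne ℏ)
  have hsub : (XX p - XX q : RF ℓ) ≠ 0 := by
    simpa [XX, CC] using (map_ne_zero_iff _ hinj).mpr (X_sub_X_add_C_ne_zero hne (0 : ℂ))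
  have hrel := h1 ε ε' p q hpq hε
  have hswap := congrArg (permRF (Equiv.swap p q)) hP
  rw [map_mul, permRF_algebraMap, permRF_algebraMap, hrel] at hswap
  have hV := congrArg (algebraMap _ (RF ℓ)) (rename_swap_quantumVandermonde ℏ hpq)
  have hD := congrArg (algebraMap _ (RF ℓ)) hPQ
  simp only [map_mul, map_sub, map_neg, map_add] at hV hD ⊢
  change (XX p - XX q - CC ℏ) * _ = (XX q - XX p - CC ℏ) * _ at hV
  change _ = (XX p - XX q) * _ at hD
  change _ = -(_ + CC ℏ * _)
  set V := algebraMap _ (RF ℓ) (quantumVandermonde ℓ ℏ)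
  set V' := algebraMap _ (RF ℓ) (rename (Equiv.swap p q) (quantumVandermonde ℓ ℏ))
  set P' := algebraMap _ (RF ℓ) (rename (Equiv.swap p q) P)
  set Q' := algebraMap _ (RF ℓ) Q
  set P₀ := algebraMap _ (RF ℓ) P
  have hclear : V' * ((XX p - XX q) * H ε + CC ℏ * H ε') = P' * (XX p - XX q + CC ℏ) := by
    rw [← hswap]
    field_simp
  have hkey : (XX p - XX q + CC ℏ) * ((XX p - XX q) * (V * H ε)) =
      (XX p - XX q + CC ℏ) * ((XX p - XX q) * -(P' + CC ℏ * Q')) := by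
    linear_combination ((XX p - XX q) * H ε + CC ℏ * H ε') * hV
      - (XX p - XX q - CC ℏ) * hclear - (XX p - XX q + CC ℏ) * CC ℏ * hP
      - (XX p - XX q + CC ℏ) * CC ℏ * hD
  exact mul_left_cancel₀ hsub (mul_left_cancel₀ hadd hkey)

theorem HRel3.quantumVandermonde_mul {N m ℓ : ℕ} {ℏ : ℂ} {H : IdxT N m ℓ → RF ℓ}
    (h3 : HRel3 N m ℓ ℏ H) {ε : IdxT N m ℓ} (hε : ε.1 = fun a : Fin ℓ => (a : ℕ) / m) :
    algebraMap _ (RF ℓ) (quantumVandermonde ℓ ℏ) * H ε =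
      algebraMap _ (RF ℓ) (blockVandermonde ℓ m ℏ) := by
  have hinj := IsFractionRing.injective (MvPolynomial (Fin ℓ) ℂ) (RF ℓ)
  rw [h3 ε hε, ← blockVandermonde_mul ℓ m ℏ, Finset.prod_inv_distrib, map_mul, map_prod]
  simp only [map_sub]
  refine mul_inv_cancel_right₀ (Finset.prod_ne_zero_iff.mpr fun ab hab => ?_) _
  have hne : ab.1 ≠ ab.2 := fun h => by simp [h] at hab
  simpa using (map_ne_zero_iff _ hinj).mpr (X_sub_X_sub_C_ne_zero hne ℏ)

/-- if a family `{H_ε}` of rational functions satisfies the exchange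
relation (rel1) and the normalization (rel3), then for every admissible index tuple
`ε` the rational function `∏_{1≤a<b≤ℓ}(α_a−α_b−ℏ)·H_ε` is a polynomial whose degree
in each single variable is at most `m−1`. -/
theorem statement1 (N m : ℕ) (hN : 2 ≤ N) (hm : 1 ≤ m) (ℏ : ℂ) (hℏ : ℏ ≠ 0)
    (H : IdxT N m ((N - 1) * m) → RF ((N - 1) * m))
    (h1 : HRel1 N m ((N - 1) * m) ℏ H) (h3 : HRel3 N m ((N - 1) * m) ℏ H) :
    ∀ ε : IdxT N m ((N - 1) * m),
      ∃ P : MvPolynomial (Fin ((N - 1) * m)) ℂ,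
        (∀ a, P.degreeOf a ≤ m - 1) ∧
        (∏ ab ∈ Finset.univ.filter
            (fun ab : Fin ((N - 1) * m) × Fin ((N - 1) * m) => ab.1 < ab.2),
          (XX ab.1 - XX ab.2 - CC ℏ)) * H ε =
          algebraMap (MvPolynomial (Fin ((N - 1) * m)) ℂ) (RF ((N - 1) * m)) P := by
  simp only [← algebraMap_quantumVandermonde]
  rintro ⟨ε, hε⟩
  induction ε using tuple_induction_of_monotone with
  | mono ε hmono =>
    exact ⟨_, degreeOf_blockVandermonde_le _ hm ℏ,
      h3.quantumVandermonde_mul (hε.eq_div_of_monotone hN hm hmono)⟩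
  | swap ε p q hpq ih =>
    have hε' : IsIdx N m ((N - 1) * m) ε := by
      simpa [Function.comp_assoc, ← Equiv.Perm.coe_mul] using hε.comp_perm (Equiv.swap p q)
    obtain ⟨P, hdeg, hP⟩ := ih hε'
    refine h1.exists_polynomial_swap (ε' := ⟨ε, hε'⟩) hpq ?_ hdeg hP
    simp [Function.comp_assoc, ← Equiv.Perm.coe_mul]

end
end

section
/- Fix N ≥ 2, m ≥ 1, set n = Nm, ℓ = (N−1)m, and let ℏ ≠ 0. Let {H_ε} be a family of rational functions in ℓ variables, indexed by tuples ε with entries in {0,…,N−2} satisfying #{a : ε_a ≥ j} = (N−1−j)m, that satisfies (rel1) and (rel2). For J ∈ Z_{ν₁,…,ν_{N−1}} with ν_j = (N−j)m, define w_J := Skew_{α₁,…,α_ℓ}( g_{M₁^J}(α₁,…,α_ℓ | β₁,…,β_n) · H_{J̄}(α₁,…,α_ℓ) ), where J̄ is the ℓ-tuple obtained from J by deleting its zero entries and subtracting 1 from each remaining entry. Then for every J' ∈ Z_{ℓ−1,(N−2)m,…,2m,m} the following identity of rational functions holds: ℏ · Σ_{a: J'_a = 0} w_{(J'₁,…,J'_a+1,…,J'_n)}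 = Skew_{α₁,…,α_ℓ}( g_{M₁^{J'}}(α₂,…,α_ℓ | β₁,…,β_n) · { ∏_{a=2}^{ℓ}(α₁−α_a−ℏ) · H(α₁) − ∏_{j=1}^{n}(α₁−β_j−ℏ)/(α₁−β_j) · ∏_{a=2}^{ℓ}(α₁−α_a+(N−1)ℏ) · H(α₁+Nℏ) } ), where H(x) := H_{0,J̄'₁,…,J̄'_{ℓ−1}}(x,α₂,…,α_ℓ). -/
open Finset
open scoped Classical

noncomputable section

/-- A generic point: the pairwise differences of the coordinates avoid the lattice
`ℤ·ℏ` (in particular all denominators occurring in the relations below, which are of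
the form `α_a − α_b + kℏ`, are nonzero at such points). -/
def GenPt {n : ℕ} (ℏ : ℂ) (α : Fin n → ℂ) : Prop :=
  ∀ a b : Fin n, a ≠ b → ∀ k : ℤ, α a - α b ≠ (k : ℂ) * ℏ

/-- (rel1), the exchange relation, stated pointwise wherever the denominator is
nonzero:  `H_{…,ε_{p+1},ε_p,…}(…,α_{p+1},α_p,…)
 = (α_p−α_{p+1})/(α_p−α_{p+1}+ℏ)·H_{…,ε_p,ε_{p+1},…}(…,α_p,α_{p+1},…)
 + ℏ/(α_p−α_{p+1}+ℏ)·H_{…,ε_{p+1},ε_p,…}(…,α_p,α_{p+1},…)`.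
Here `ε' = ε ∘ swap p q` is `ε` with the `p`-th and `(p+1)`-st entries interchanged
and `α ∘ swap p q` is `α` with the `p`-th and `(p+1)`-st arguments interchanged. -/
def PHRel1 (N m ℓ : ℕ) (ℏ : ℂ) (H : IdxT N m ℓ → (Fin ℓ → ℂ) → ℂ) : Prop :=
  ∀ (ε ε' : IdxT N m ℓ) (p q : Fin ℓ),
    (q : ℕ) = (p : ℕ) + 1 → ε'.1 = ε.1 ∘ Equiv.swap p q →
    ∀ α : Fin ℓ → ℂ, α p - α q + ℏ ≠ 0 →
      H ε' (α ∘ Equiv.swap p q) =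
        (α p - α q) / (α p - α q + ℏ) * H ε α + ℏ / (α p - α q + ℏ) * H ε' α

/-- (rel2), the shift relation, stated pointwise wherever the denominators are
nonzero:  `H_{ε₁,…,ε_ℓ}(α₁,…,α_{ℓ−1},α_ℓ−Nℏ)
 = ∏_{a=1}^{ℓ−1}(α_a−α_ℓ+ℏ)/(α_a−α_ℓ+(N−1)ℏ) · H_{ε_ℓ,ε₁,…,ε_{ℓ−1}}(α_ℓ,α₁,…,α_{ℓ−1})`.
Here `t` is the last index and `ε' = ε ∘ (finRotate ℓ).symm = (ε_ℓ,ε₁,…,ε_{ℓ−1})`. -/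
def PHRel2 (N m ℓ : ℕ) (ℏ : ℂ) (H : IdxT N m ℓ → (Fin ℓ → ℂ) → ℂ) : Prop :=
  ∀ (ε ε' : IdxT N m ℓ) (t : Fin ℓ), (t : ℕ) = ℓ - 1 →
    ε'.1 = ε.1 ∘ (finRotate ℓ).symm →
    ∀ α : Fin ℓ → ℂ, (∀ a, a ≠ t → α a - α t + ((N : ℂ) - 1) * ℏ ≠ 0) →
      H ε (Function.update α t (α t - (N : ℂ) * ℏ)) =
        (∏ a ∈ Finset.univ.erase t,
          (α a - α t + ℏ) / (α a - α t + ((N : ℂ) - 1) * ℏ)) *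
          H ε' (α ∘ (finRotate ℓ).symm)

/-- (rel3), the normalization, stated pointwise wherever the denominators are
nonzero: for the increasing index tuple `ε = (0^m,1^m,…,(N−2)^m)` (i.e. `ε_a = ⌊a/m⌋`),
`H_ε = ∏_{(a,b) : ε_a<ε_b} 1/(α_a−α_b−ℏ)`, the product over all ordered pairs `(a,b)`
with `ε_a < ε_b`. -/
def PHRel3 (N m ℓ : ℕ) (ℏ : ℂ) (H : IdxT N m ℓ → (Fin ℓ → ℂ) → ℂ) : Prop :=
  ∀ ε : IdxT N m ℓ, ε.1 = (fun a : Fin ℓ => (a : ℕ) / m) →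
    ∀ α : Fin ℓ → ℂ,
      (∀ ab : Fin ℓ × Fin ℓ, (ab.1 : ℕ) / m < (ab.2 : ℕ) / m → α ab.1 - α ab.2 - ℏ ≠ 0) →
      H ε α = ∏ ab ∈ Finset.univ.filter
          (fun ab : Fin ℓ × Fin ℓ => (ab.1 : ℕ) / m < (ab.2 : ℕ) / m),
        (α ab.1 - α ab.2 - ℏ)⁻¹

/-- The function `g_K(t₁,…,t_l | z₁,…,z_{m'})` of Section 3, where the subset
`K = {k₁ < ⋯ < k_l}` is encoded by its increasing enumeration `e : Fin l → Fin m'`. -/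
def gfun {l m' : ℕ} (ℏ : ℂ) (e : Fin l → Fin m') (t : Fin l → ℂ) (z : Fin m' → ℂ) : ℂ :=
  (∏ a : Fin l,
    ((t a - z (e a))⁻¹ *
      ∏ j ∈ Finset.univ.filter fun j => j < e a, (t a - z j - ℏ) / (t a - z j))) *
    ∏ ab ∈ Finset.univ.filter fun ab : Fin l × Fin l => ab.1 < ab.2,
      (t ab.1 - t ab.2 - ℏ)

/-- `e` is the increasing enumeration of the set `s`. -/
def EnumOf {k n : ℕ} (e : Fin k → Fin n) (s : Set (Fin n)) : Prop :=
  StrictMono e ∧ ∀ r, r ∈ s ↔ ∃ a, e a = r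

/-- The partial product `∏_{j < s} (x − β_j − ℏ)/(x − β_j)` over the first `s` indices. -/
def shiftProd {n : ℕ} (ℏ : ℂ) (β : Fin n → ℂ) (s : ℕ) (x : ℂ) : ℂ :=
  ∏ j ∈ Finset.univ.filter fun j : Fin n => (j : ℕ) < s, (x - β j - ℏ) / (x - β j)

lemma shiftProd_zero {n : ℕ} (ℏ : ℂ) (β : Fin n → ℂ) (x : ℂ) : shiftProd ℏ β 0 x = 1 := by
  simp [shiftProd]

lemma shiftProd_top {n : ℕ} (ℏ : ℂ) (β : Fin n → ℂ) (x : ℂ) :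
    shiftProd ℏ β n x = ∏ j, (x - β j - ℏ) / (x - β j) := by
  simp [shiftProd]

lemma shiftProd_succ {n : ℕ} (ℏ : ℂ) (β : Fin n → ℂ) (s : Fin n) (x : ℂ) :
    shiftProd ℏ β ((s : ℕ) + 1) x = (x - β s - ℏ) / (x - β s) * shiftProd ℏ β s x := by
  have h : (Finset.univ.filter fun j : Fin n => (j : ℕ) < s + 1) =
      insert s (Finset.univ.filter fun j : Fin n => (j : ℕ) < s) := by
    ext j
    simp only [Finset.mem_filter, Finset.mem_univ, true_and, Finset.mem_insert, Fin.ext_iff]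
    omega
  rw [shiftProd, h, Finset.prod_insert (by simp), shiftProd]

/-- Splitting off the `p`-th entry from `g`. -/
lemma gfun_succAbove {l n : ℕ} (ℏ : ℂ) (E : Fin (l + 1) → Fin n) (t : Fin (l + 1) → ℂ)
    (z : Fin n → ℂ) (p : Fin (l + 1)) :
    gfun ℏ E t z = gfun ℏ (E ∘ p.succAbove) (t ∘ p.succAbove) z *
      ((t p - z (E p))⁻¹ * shiftProd ℏ z (E p) (t p)) *
      ∏ i : Fin l, if p.succAbove i < p then t (p.succAbove i) - t p - ℏ
        else t p - t (p.succAbove i) - ℏ := by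
  simp only [gfun, Finset.prod_filter (fun ab : Fin _ × Fin _ => ab.1 < ab.2),
    Fintype.prod_prod_type]
  rw [Fin.prod_univ_succAbove _ p, Fin.prod_univ_succAbove _ p, Fin.prod_univ_succAbove _ p]
  simp only [Fin.prod_univ_succAbove _ p, Finset.prod_mul_distrib, lt_irrefl, if_false,
    Fin.succAbove_lt_succAbove_iff, Function.comp_apply, shiftProd]
  have h : (∏ i : Fin l, if p.succAbove i < p then t (p.succAbove i) - t p - ℏ
        else t p - t (p.succAbove i) - ℏ) =
      (∏ i : Fin l, if p < p.succAbove i then t p - t (p.succAbove i) - ℏ else 1) *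
      ∏ i : Fin l, if p.succAbove i < p then t (p.succAbove i) - t p - ℏ else 1 := by
    rw [← Finset.prod_mul_distrib]
    refine Finset.prod_congr rfl fun i _ => ?_
    rcases lt_or_gt_of_ne (Fin.succAbove_ne p i) with hi | hi
    · simp [hi, hi.not_gt]
    · simp [hi, hi.not_gt]
  simp only [Fin.lt_def (b := E _)]
  rw [h]
  ring

/-- The expression interpolating between the two terms of the right-hand side: the index
`E 0` and the variable `u 0` have been moved to position `p`. -/
def interp {l n : ℕ} (ℏ : ℂ) (F : (Fin (l + 1) → ℕ) → (Fin (l + 1) → ℂ) → ℂ)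
    (E : Fin (l + 1) → ℕ) (e : Fin l → Fin n) (β : Fin n → ℂ) (p : Fin (l + 1)) (s : ℕ)
    (u : Fin (l + 1) → ℂ) : ℂ :=
  gfun ℏ e (u ∘ Fin.succ) β * shiftProd ℏ β s (u 0) *
    (∏ i : Fin l, if i.castSucc < p then u 0 - u i.succ + ℏ else u 0 - u i.succ - ℏ) *
    F (E ∘ p.cycleRange) (u ∘ p.cycleRange)

lemma exchange_identity {ℏ x y b A B A' B' : ℂ} (hx : x - b ≠ 0) (hy : y - b ≠ 0)
    (h1 : (x - y + ℏ) * B' = (x - y) * A + ℏ * B)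
    (h2 : (x - y + ℏ) * A' = (x - y) * B + ℏ * A) :
    (y - b)⁻¹ * ((x - y - ℏ) * A - (x - b - ℏ) / (x - b) * (x - y + ℏ) * B') =
      (x - b)⁻¹ * ((y - x - ℏ) * A' - (y - b - ℏ) / (y - b) * (y - x + ℏ) * B) := by
  field_simp
  linear_combination (-(x - b - ℏ)) * h1 + (y - b) * h2

lemma cycleRange_succ {l : ℕ} (b : Fin l) :
    b.succ.cycleRange = b.castSucc.cycleRange * Equiv.swap b.castSucc b.succ := by
  ext i
  rcases eq_or_ne i b.castSucc with rfl | h1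
  · rw [Equiv.Perm.mul_apply, Equiv.swap_apply_left,
      Fin.cycleRange_of_gt Fin.castSucc_lt_succ, Fin.coe_cycleRange_of_lt Fin.castSucc_lt_succ]
    simp
  rcases eq_or_ne i b.succ with rfl | h2
  · simp
  rw [Equiv.Perm.mul_apply, Equiv.swap_apply_of_ne_of_ne h1 h2]
  rcases lt_or_gt_of_ne h1 with h | h
  · rw [Fin.coe_cycleRange_of_lt h, Fin.coe_cycleRange_of_lt (h.trans Fin.castSucc_lt_succ)]
  · have h' : b.succ < i := by
      rw [Ne, Fin.ext_iff, Fin.val_succ] at h2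
      rw [Fin.lt_def, Fin.val_castSucc] at h
      rw [Fin.lt_def, Fin.val_succ]
      omega
    rw [Fin.cycleRange_of_gt h, Fin.cycleRange_of_gt h']

lemma swap_mul_cycleRange {l : ℕ} (b : Fin l) :
    Equiv.swap 0 b.succ * b.castSucc.cycleRange =
      b.castSucc.cycleRange * Equiv.swap b.castSucc b.succ := by
  rw [Equiv.mul_swap_eq_swap_mul, Fin.cycleRange_self,
    Fin.cycleRange_of_gt Fin.castSucc_lt_succ]

/-- Moving the variable `u 0` past `u b.succ` does not change the interpolating expression up
to terms symmetric in these two variables. -/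
lemma interp_exchange {l n : ℕ} {ℏ : ℂ} {F : (Fin (l + 1) → ℕ) → (Fin (l + 1) → ℂ) → ℂ}
    (hF : ∀ (ε : Fin (l + 1) → ℕ) (p q : Fin (l + 1)), (q : ℕ) = p + 1 →
      ∀ v : Fin (l + 1) → ℂ, v p - v q + ℏ ≠ 0 →
      (v p - v q + ℏ) * F (ε ∘ Equiv.swap p q) (v ∘ Equiv.swap p q) =
        (v p - v q) * F ε v + ℏ * F (ε ∘ Equiv.swap p q) v)
    (E : Fin (l + 1) → ℕ) (e : Fin l → Fin n) (β : Fin n → ℂ) (b : Fin l)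
    (u : Fin (l + 1) → ℂ) (hx : u 0 - β (e b) ≠ 0) (hy : u b.succ - β (e b) ≠ 0)
    (hd : u 0 - u b.succ + ℏ ≠ 0) :
    interp ℏ F E e β b.castSucc (e b) u - interp ℏ F E e β b.succ ((e b : ℕ) + 1) u =
      interp ℏ F E e β b.castSucc (e b) (u ∘ Equiv.swap 0 b.succ) -
        interp ℏ F E e β b.succ ((e b : ℕ) + 1) (u ∘ Equiv.swap 0 b.succ) := by
  obtain ⟨k, rfl⟩ : ∃ k, l = k + 1 := ⟨l - 1, by have := b.isLt; omega⟩
  have hsw : ∀ i : Fin k, Equiv.swap 0 b.succ (b.succAbove i).succ = (b.succAbove i).succ :=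
    fun i => Equiv.swap_apply_of_ne_of_ne (Fin.succ_ne_zero _)
      (by simp [Fin.succAbove_ne])
  have hpre : ∀ (p : Fin (k + 2)) (s : ℕ) (w : Fin (k + 2) → ℂ),
      (∀ i, (b.succAbove i).castSucc < p ↔ b.succAbove i < b) →
      interp ℏ F E e β p s w = gfun ℏ (e ∘ b.succAbove) (w ∘ Fin.succ ∘ b.succAbove) β *
        ((w b.succ - β (e b))⁻¹ * shiftProd ℏ β (e b) (w b.succ)) * shiftProd ℏ β s (w 0) *
        (if b.castSucc < p then w 0 - w b.succ + ℏ else w 0 - w b.succ - ℏ) *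
        (∏ i : Fin k, if b.succAbove i < b then
            (w (b.succAbove i).succ - w b.succ - ℏ) * (w 0 - w (b.succAbove i).succ + ℏ)
          else (w b.succ - w (b.succAbove i).succ - ℏ) * (w 0 - w (b.succAbove i).succ - ℏ)) *
        F (E ∘ p.cycleRange) (w ∘ p.cycleRange) := by
    intro p s w hp
    rw [interp, gfun_succAbove ℏ e (w ∘ Fin.succ) β b, Fin.prod_univ_succAbove _ b]
    have : ∀ i : Fin k, (if b.succAbove i < b then
            (w (b.succAbove i).succ - w b.succ - ℏ) * (w 0 - w (b.succAbove i).succ + ℏ)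
          else (w b.succ - w (b.succAbove i).succ - ℏ) * (w 0 - w (b.succAbove i).succ - ℏ)) =
        (if b.succAbove i < b then w (b.succAbove i).succ - w b.succ - ℏ
          else w b.succ - w (b.succAbove i).succ - ℏ) *
        (if b.succAbove i < b then w 0 - w (b.succAbove i).succ + ℏ
          else w 0 - w (b.succAbove i).succ - ℏ) := by
      intro i
      split_ifs <;> rfl
    simp only [this, hp, Finset.prod_mul_distrib, Function.comp_apply, Function.comp_assoc]
    ring
  have hc : ∀ i, (b.succAbove i).castSucc < b.castSucc ↔ b.succAbove i < b :=
    fun i => Fin.castSucc_lt_castSucc_iff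
  have hs : ∀ i, (b.succAbove i).castSucc < b.succ ↔ b.succAbove i < b := by
    intro i
    have := Fin.succAbove_ne b i
    rw [Ne, Fin.ext_iff] at this
    simp only [Fin.lt_def, Fin.val_castSucc, Fin.val_succ]
    omega
  have hu0 : (u ∘ Equiv.swap 0 b.succ) 0 = u b.succ := by simp
  have hub : (u ∘ Equiv.swap 0 b.succ) b.succ = u 0 := by simp
  have hur : ∀ i : Fin k, (u ∘ Equiv.swap 0 b.succ) (b.succAbove i).succ =
      u (b.succAbove i).succ := fun i => by simp [hsw i]
  have hurest : (u ∘ Equiv.swap 0 b.succ) ∘ Fin.succ ∘ b.succAbove =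
      u ∘ Fin.succ ∘ b.succAbove := funext hur
  have hcs : (b.succ.cycleRange : Fin (k + 2) → Fin (k + 2)) =
      b.castSucc.cycleRange ∘ Equiv.swap b.castSucc b.succ := by
    rw [cycleRange_succ]; rfl
  have hv : (u ∘ Equiv.swap 0 b.succ) ∘ b.castSucc.cycleRange =
      (u ∘ b.castSucc.cycleRange) ∘ Equiv.swap b.castSucc b.succ := by
    have := congrArg (fun g : Equiv.Perm (Fin (k + 2)) => u ∘ g) (swap_mul_cycleRange b)
    simpa only [Equiv.Perm.coe_mul, Function.comp_assoc] using this
  have hss : ∀ {X : Type} (f : Fin (k + 2) → X),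
      (f ∘ Equiv.swap b.castSucc b.succ) ∘ Equiv.swap b.castSucc b.succ = f :=
    fun f => by ext i; simp
  rw [hpre _ _ u hc, hpre _ _ u hs, hpre _ _ _ hc, hpre _ _ _ hs]
  rw [hcs]
  simp only [← Function.comp_assoc]
  simp only [Function.comp_assoc _ Fin.succ]
  rw [hurest, hv, hss]
  simp only [hu0, hub, hur, lt_irrefl, if_false, Fin.castSucc_lt_succ, if_true,
    shiftProd_succ]
  have hv0 : (u ∘ b.castSucc.cycleRange) b.castSucc = u 0 := by simp
  have hv1 : (u ∘ b.castSucc.cycleRange) b.succ = u b.succ := by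
    simp [Fin.cycleRange_of_gt Fin.castSucc_lt_succ]
  have r1 := hF (E ∘ b.castSucc.cycleRange) b.castSucc b.succ (by simp)
    (u ∘ b.castSucc.cycleRange) (by rw [hv0, hv1]; exact hd)
  have r2 := hF ((E ∘ b.castSucc.cycleRange) ∘ Equiv.swap b.castSucc b.succ)
    b.castSucc b.succ (by simp) (u ∘ b.castSucc.cycleRange) (by rw [hv0, hv1]; exact hd)
  rw [hss] at r2
  rw [hv0, hv1] at r1 r2
  have key := exchange_identity hx hy r1 r2
  have hQ : (∏ i : Fin k, if b.succAbove i < b then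
        (u (b.succAbove i).succ - u 0 - ℏ) * (u b.succ - u (b.succAbove i).succ + ℏ)
      else (u 0 - u (b.succAbove i).succ - ℏ) * (u b.succ - u (b.succAbove i).succ - ℏ)) =
      ∏ i : Fin k, if b.succAbove i < b then
        (u (b.succAbove i).succ - u b.succ - ℏ) * (u 0 - u (b.succAbove i).succ + ℏ)
      else (u b.succ - u (b.succAbove i).succ - ℏ) * (u 0 - u (b.succAbove i).succ - ℏ) := by
    refine Finset.prod_congr rfl fun i _ => ?_
    split_ifs <;> ring
  rw [hQ]
  generalize (∏ i : Fin k, if b.succAbove i < b then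
        (u (b.succAbove i).succ - u b.succ - ℏ) * (u 0 - u (b.succAbove i).succ + ℏ)
      else (u b.succ - u (b.succAbove i).succ - ℏ) *
        (u 0 - u (b.succAbove i).succ - ℏ)) = Q at *
  linear_combination (gfun ℏ (e ∘ b.succAbove) (u ∘ Fin.succ ∘ b.succAbove) β *
    shiftProd ℏ β (e b) (u b.succ) * shiftProd ℏ β (e b) (u 0) * Q) * key

/-- If `K` enumerates the image of `e` together with a new element `s = K p`, then passing
`s` produces the function `g` of the enlarged set. -/
lemma interp_insert {l n : ℕ} {ℏ : ℂ} (F : (Fin (l + 1) → ℕ) → (Fin (l + 1) → ℂ) → ℂ)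
    (E : Fin (l + 1) → ℕ) (K : Fin (l + 1) → Fin n) (β : Fin n → ℂ) (p : Fin (l + 1))
    (u : Fin (l + 1) → ℂ) (hx : u 0 - β (K p) ≠ 0) :
    interp ℏ F E (K ∘ p.succAbove) β p (K p) u -
        interp ℏ F E (K ∘ p.succAbove) β p ((K p : ℕ) + 1) u =
      ℏ * ((Equiv.Perm.sign p.cycleRange : ℤ) : ℂ) *
        (gfun ℏ K (u ∘ p.cycleRange) β * F (E ∘ p.cycleRange) (u ∘ p.cycleRange)) := by
  have hsign : ((Equiv.Perm.sign p.cycleRange : ℤ) : ℂ) =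
      ∏ i : Fin l, if i.castSucc < p then -1 else 1 := by
    rw [Fin.sign_cycleRange, Finset.prod_ite, Finset.prod_const, Finset.prod_const_one, mul_one]
    have : (Finset.univ.filter fun i : Fin l => i.castSucc < p).card = p := by
      simp only [Fin.lt_def, Fin.val_castSucc]
      rw [Fin.card_filter_val_lt]
      exact min_eq_right (by have := p.isLt; omega)
    rw [this]
    push_cast
    rfl
  have hp : (u ∘ p.cycleRange) p = u 0 := by simp
  have hsa : (u ∘ p.cycleRange) ∘ p.succAbove = u ∘ Fin.succ := by ext i; simp
  have hsa' : ∀ i, (u ∘ p.cycleRange) (p.succAbove i) = u i.succ := fun i => by simp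
  have hprod : (∏ i : Fin l, if i.castSucc < p then u 0 - u i.succ + ℏ
        else u 0 - u i.succ - ℏ) =
      (∏ i : Fin l, if i.castSucc < p then -1 else 1) *
      ∏ i : Fin l, if i.castSucc < p then u i.succ - u 0 - ℏ else u 0 - u i.succ - ℏ := by
    rw [← Finset.prod_mul_distrib]
    refine Finset.prod_congr rfl fun i _ => ?_
    split_ifs <;> ring
  rw [interp, interp, gfun_succAbove ℏ K _ β p, hsa, hp, shiftProd_succ]
  simp only [hsa', Fin.succAbove_lt_iff_castSucc_lt]
  rw [hsign, hprod]
  field_simp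
  ring

lemma sum_sign_interp_exchange {l n : ℕ} {ℏ : ℂ}
    {F : (Fin (l + 1) → ℕ) → (Fin (l + 1) → ℂ) → ℂ}
    (hF : ∀ (ε : Fin (l + 1) → ℕ) (p q : Fin (l + 1)), (q : ℕ) = p + 1 →
      ∀ v : Fin (l + 1) → ℂ, v p - v q + ℏ ≠ 0 →
      (v p - v q + ℏ) * F (ε ∘ Equiv.swap p q) (v ∘ Equiv.swap p q) =
        (v p - v q) * F ε v + ℏ * F (ε ∘ Equiv.swap p q) v)
    (E : Fin (l + 1) → ℕ) (e : Fin l → Fin n) (β : Fin n → ℂ) (b : Fin l)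
    (α : Fin (l + 1) → ℂ) (hα : ∀ i j, i ≠ j → α i - α j + ℏ ≠ 0)
    (hαβ : ∀ i j, α i - β j ≠ 0) :
    ∑ σ : Equiv.Perm (Fin (l + 1)), ((Equiv.Perm.sign σ : ℤ) : ℂ) *
      (interp ℏ F E e β b.castSucc (e b) (α ∘ σ) -
        interp ℏ F E e β b.succ ((e b : ℕ) + 1) (α ∘ σ)) = 0 := by
  have hne : (0 : Fin (l + 1)) ≠ b.succ := (Fin.succ_ne_zero b).symm
  refine Finset.sum_involution (fun σ _ => σ * Equiv.swap 0 b.succ) ?_ ?_ ?_ ?_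
  · intro σ _
    have h := interp_exchange hF E e β b (α ∘ σ) (hαβ _ _) (hαβ _ _)
      (hα _ _ (σ.injective.ne hne))
    rw [Equiv.Perm.coe_mul, ← Function.comp_assoc, ← h, Equiv.Perm.sign_mul,
      Equiv.Perm.sign_swap hne]
    push_cast
    ring
  · intro σ _ _ h
    exact hne (Equiv.swap_eq_one_iff.mp (mul_eq_left.mp h))
  · intro σ _
    exact Finset.mem_univ _
  · intro σ _
    simp [mul_assoc]

lemma sum_sign_interp_insert {l n : ℕ} {ℏ : ℂ} (F : (Fin (l + 1) → ℕ) → (Fin (l + 1) → ℂ) → ℂ)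
    (E : Fin (l + 1) → ℕ) (K : Fin (l + 1) → Fin n) (β : Fin n → ℂ) (p : Fin (l + 1))
    (α : Fin (l + 1) → ℂ) (hαβ : ∀ i j, α i - β j ≠ 0) :
    ∑ σ : Equiv.Perm (Fin (l + 1)), ((Equiv.Perm.sign σ : ℤ) : ℂ) *
      (interp ℏ F E (K ∘ p.succAbove) β p (K p) (α ∘ σ) -
        interp ℏ F E (K ∘ p.succAbove) β p ((K p : ℕ) + 1) (α ∘ σ)) =
    ℏ * ∑ σ : Equiv.Perm (Fin (l + 1)), ((Equiv.Perm.sign σ : ℤ) : ℂ) *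
      (gfun ℏ K (α ∘ σ) β * F (E ∘ p.cycleRange) (α ∘ σ)) := by
  rw [← Equiv.sum_comp (Equiv.mulRight p.cycleRange) (fun σ : Equiv.Perm (Fin (l + 1)) =>
    ((Equiv.Perm.sign σ : ℤ) : ℂ) * (gfun ℏ K (α ∘ σ) β * F (E ∘ p.cycleRange) (α ∘ σ))),
    Finset.mul_sum]
  refine Finset.sum_congr rfl fun σ _ => ?_
  rw [interp_insert F E K β p (α ∘ σ) (hαβ _ _), Equiv.coe_mulRight, Equiv.Perm.sign_mul,
    Equiv.Perm.coe_mul]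
  push_cast
  simp only [Function.comp_assoc]
  ring

/-- The number of entries of `e` below `s`. -/
def insertPos {l n : ℕ} (e : Fin l → Fin n) (s : ℕ) : Fin (l + 1) :=
  ⟨(Finset.univ.filter fun i => (e i : ℕ) < s).card,
    Nat.lt_succ_of_le ((Finset.card_le_univ _).trans (Fintype.card_fin l).le)⟩

lemma insertPos_eq {l n : ℕ} {e : Fin l → Fin n} {s : ℕ} {p : Fin (l + 1)}
    (h : ∀ i : Fin l, i.castSucc < p ↔ (e i : ℕ) < s) : insertPos e s = p := by
  ext
  simp only [insertPos, ← h, Fin.lt_def, Fin.val_castSucc]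
  rw [Fin.card_filter_val_lt]
  exact min_eq_right (by have := p.isLt; omega)

/-- The identity between the antisymmetrizations, obtained by moving the distinguished variable
through all positions. -/
lemma sum_insert_eq {l n : ℕ} {ℏ : ℂ} {F : (Fin (l + 1) → ℕ) → (Fin (l + 1) → ℂ) → ℂ}
    (hF : ∀ (ε : Fin (l + 1) → ℕ) (p q : Fin (l + 1)), (q : ℕ) = p + 1 →
      ∀ v : Fin (l + 1) → ℂ, v p - v q + ℏ ≠ 0 →
      (v p - v q + ℏ) * F (ε ∘ Equiv.swap p q) (v ∘ Equiv.swap p q) =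
        (v p - v q) * F ε v + ℏ * F (ε ∘ Equiv.swap p q) v)
    (E : Fin (l + 1) → ℕ) (e : Fin l → Fin n) (he : StrictMono e) (β : Fin n → ℂ)
    (K : Fin n → Fin (l + 1) → Fin n) (D : Fin n → Fin (l + 1) → ℕ) (S : Finset (Fin n))
    (hS : ∀ s, s ∉ S → ∃ b, e b = s)
    (hK : ∀ s ∈ S, ∃ p : Fin (l + 1), StrictMono (K s) ∧ K s p = s ∧ K s ∘ p.succAbove = e ∧
      D s = E ∘ p.cycleRange)
    (α : Fin (l + 1) → ℂ) (hα : ∀ i j, i ≠ j → α i - α j + ℏ ≠ 0)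
    (hαβ : ∀ i j, α i - β j ≠ 0) :
    ℏ * ∑ s ∈ S, ∑ σ : Equiv.Perm (Fin (l + 1)), ((Equiv.Perm.sign σ : ℤ) : ℂ) *
        (gfun ℏ (K s) (α ∘ σ) β * F (D s) (α ∘ σ)) =
      ∑ σ : Equiv.Perm (Fin (l + 1)), ((Equiv.Perm.sign σ : ℤ) : ℂ) *
        (interp ℏ F E e β 0 0 (α ∘ σ) - interp ℏ F E e β (Fin.last l) n (α ∘ σ)) := by
  set T : ℕ → ℂ := fun s => ∑ σ : Equiv.Perm (Fin (l + 1)), ((Equiv.Perm.sign σ : ℤ) : ℂ) *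
    interp ℏ F E e β (insertPos e s) s (α ∘ σ) with hT
  have hT' : ∀ s t : ℕ, T s - T t = ∑ σ : Equiv.Perm (Fin (l + 1)),
      ((Equiv.Perm.sign σ : ℤ) : ℂ) * (interp ℏ F E e β (insertPos e s) s (α ∘ σ) -
        interp ℏ F E e β (insertPos e t) t (α ∘ σ)) := by
    intro s t
    simp only [hT, mul_sub, Finset.sum_sub_distrib]
  have h0 : insertPos e 0 = 0 := insertPos_eq (by simp)
  have hn : insertPos e n = Fin.last l := insertPos_eq (by simp [Fin.castSucc_lt_last])
  have hstep : ∀ s : Fin n, T s - T (s + 1) = if s ∈ S then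
      ℏ * ∑ σ : Equiv.Perm (Fin (l + 1)), ((Equiv.Perm.sign σ : ℤ) : ℂ) *
        (gfun ℏ (K s) (α ∘ σ) β * F (D s) (α ∘ σ)) else 0 := by
    intro s
    rw [hT']
    split_ifs with hs
    · obtain ⟨p, hmono, hp, hsa, hD⟩ := hK s hs
      have key : ∀ i : Fin l, i.castSucc < p ↔ e i < s := by
        intro i
        rw [← Fin.succAbove_lt_iff_castSucc_lt, ← hmono.lt_iff_lt, hp]
        exact congrFun hsa i ▸ Iff.rfl
      have hne : ∀ i, e i ≠ s := by
        intro i h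
        rw [← hsa, ← hp, hp] at h
        exact Fin.succAbove_ne p i (hmono.injective (h.trans hp.symm))
      have e1 : insertPos e s = p := insertPos_eq key
      have e2 : insertPos e ((s : ℕ) + 1) = p := insertPos_eq fun i => by
        rw [key, Fin.lt_def]
        have := hne i
        rw [Ne, Fin.ext_iff] at this
        omega
      rw [e1, e2, hD]
      have := sum_sign_interp_insert (ℏ := ℏ) F E (K s) β p α hαβ
      rwa [hp, hsa] at this
    · obtain ⟨b, rfl⟩ := hS s hs
      have e1 : insertPos e (e b) = b.castSucc := insertPos_eq fun i => by
        rw [Fin.castSucc_lt_castSucc_iff, ← Fin.lt_def, he.lt_iff_lt]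
      have e2 : insertPos e ((e b : ℕ) + 1) = b.succ := insertPos_eq fun i => by
        rw [Fin.castSucc_lt_succ_iff, Nat.lt_succ_iff, ← Fin.le_def, he.le_iff_le]
      rw [e1, e2]
      exact sum_sign_interp_exchange hF E e β b α hα hαβ
  calc _ = ∑ s : Fin n, (T s - T (s + 1)) := by
        rw [Finset.mul_sum, Finset.sum_congr rfl fun s _ => hstep s, Finset.sum_ite_mem,
          Finset.univ_inter]
    _ = T 0 - T n := by
        rw [Fin.sum_univ_eq_sum_range (fun s => T s - T (s + 1)), Finset.sum_range_sub']
    _ = _ := by rw [hT', h0, hn]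

lemma isIdx_comp {N m ℓ : ℕ} (ε : Fin ℓ → ℕ) (π : Equiv.Perm (Fin ℓ)) :
    IsIdx N m ℓ (ε ∘ π) ↔ IsIdx N m ℓ ε := by
  have hc : ∀ j, (Finset.univ.filter fun a => j ≤ (ε ∘ π) a).card =
      (Finset.univ.filter fun a => j ≤ ε a).card := fun j =>
    Finset.card_equiv π (by simp)
  simp only [IsIdx, hc]
  rw [← π.forall_congr_right (q := fun a => ε a ≤ N - 2)]
  rfl

/-- Extension by zero of a family `H` to all index tuples. -/
def extendIdx {N m ℓ : ℕ} (H : IdxT N m ℓ → (Fin ℓ → ℂ) → ℂ) (ε : Fin ℓ → ℕ)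
    (v : Fin ℓ → ℂ) : ℂ :=
  if h : IsIdx N m ℓ ε then H ⟨ε, h⟩ v else 0

lemma extendIdx_coe {N m ℓ : ℕ} (H : IdxT N m ℓ → (Fin ℓ → ℂ) → ℂ) (ε : IdxT N m ℓ)
    (v : Fin ℓ → ℂ) : extendIdx H ε.1 v = H ε v :=
  dif_pos ε.2

lemma PHRel1.extendIdx {N m ℓ : ℕ} {ℏ : ℂ} {H : IdxT N m ℓ → (Fin ℓ → ℂ) → ℂ}
    (h1 : PHRel1 N m ℓ ℏ H) (ε : Fin ℓ → ℕ) (p q : Fin ℓ) (hpq : (q : ℕ) = p + 1)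
    (v : Fin ℓ → ℂ) (hv : v p - v q + ℏ ≠ 0) :
    (v p - v q + ℏ) * extendIdx H (ε ∘ Equiv.swap p q) (v ∘ Equiv.swap p q) =
      (v p - v q) * extendIdx H ε v + ℏ * extendIdx H (ε ∘ Equiv.swap p q) v := by
  by_cases hε : IsIdx N m ℓ ε
  · have hε' := (isIdx_comp ε (Equiv.swap p q)).mpr hε
    simp only [_root_.extendIdx, dif_pos hε, dif_pos hε']
    rw [h1 ⟨ε, hε⟩ ⟨_, hε'⟩ p q hpq rfl v hv]
    field_simp
  · have hε' := (isIdx_comp ε (Equiv.swap p q)).not.mpr hε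
    simp [_root_.extendIdx, hε, hε']

lemma PHRel2.extendIdx {N m l : ℕ} {ℏ : ℂ} {H : IdxT N m (l + 1) → (Fin (l + 1) → ℂ) → ℂ}
    (h2 : PHRel2 N m (l + 1) ℏ H) (ε : Fin (l + 1) → ℕ) (u : Fin (l + 1) → ℂ)
    (hu : ∀ i : Fin l, u 0 - u i.succ + ℏ ≠ 0) :
    (∏ i : Fin l, (u 0 - u i.succ + ((N : ℂ) - 1) * ℏ)) *
        extendIdx H ε (Function.update u 0 (u 0 + N * ℏ)) =
      (∏ i : Fin l, (u 0 - u i.succ + ℏ)) *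
        extendIdx H (ε ∘ (Fin.last l).cycleRange) (u ∘ (Fin.last l).cycleRange) := by
  set π : Equiv.Perm (Fin (l + 1)) := (Fin.last l).cycleRange with hπ
  set w := Function.update u 0 (u 0 + N * ℏ) with hw
  have hw0 : w 0 = u 0 + N * ℏ := by simp [hw]
  have hws : ∀ i : Fin l, w i.succ = u i.succ := fun i => by simp [hw]
  have hrot : (finRotate (l + 1)).symm = π.symm := by rw [hπ, Fin.cycleRange_last]
  have hinv : ∀ {X : Type} (f : Fin (l + 1) → X), (f ∘ π) ∘ (finRotate (l + 1)).symm = f :=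
    fun f => by rw [hrot, Function.comp_assoc, Equiv.self_comp_symm, Function.comp_id]
  have hlast : π (Fin.last l) = 0 := by simp [hπ]
  have hsucc : ∀ i, π ((Fin.last l).succAbove i) = i.succ := fun i => by
    rw [hπ, Fin.cycleRange_succAbove]
  have hne : ∀ i : Fin l, (w i.succ - w 0 + ((N : ℂ) - 1) * ℏ) ≠ 0 := by
    intro i h
    rw [hw0, hws] at h
    exact hu i (by linear_combination -h)
  have hupd : Function.update (w ∘ π) (Fin.last l) ((w ∘ π) (Fin.last l) - N * ℏ) = u ∘ π := by
    ext a
    rcases Fin.eq_self_or_eq_succAbove (Fin.last l) a with rfl | ⟨i, rfl⟩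
    · simp only [Function.update_self, Function.comp_apply, hlast, hw0]
      ring
    · rw [Function.update_of_ne (Fin.succAbove_ne _ _), Function.comp_apply,
        Function.comp_apply, hsucc, hws]
  have herase : ∀ f : Fin (l + 1) → ℂ,
      ∏ a ∈ Finset.univ.erase (Fin.last l), f a = ∏ i, f ((Fin.last l).succAbove i) := by
    intro f
    rw [← Finset.compl_singleton, ← Fin.image_succAbove_univ,
      Finset.prod_image Fin.succAbove_right_injective.injOn]
  by_cases hε : IsIdx N m (l + 1) ε
  · have hε' := (isIdx_comp ε π).mpr hε
    have h := h2 ⟨_, hε'⟩ ⟨ε, hε⟩ (Fin.last l) rfl (hinv ε).symm (w ∘ π) (by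
      intro a ha
      obtain ⟨i, rfl⟩ := Fin.exists_succAbove_eq ha
      rw [Function.comp_apply, Function.comp_apply, hsucc, hlast]
      exact hne i)
    rw [hupd, hinv, herase] at h
    simp only [Function.comp_apply, hsucc, hlast] at h
    simp only [_root_.extendIdx, dif_pos hε, dif_pos hε']
    rw [h, ← mul_assoc, ← Finset.prod_mul_distrib]
    congr 1
    refine Finset.prod_congr rfl fun i _ => ?_
    rw [mul_div_assoc', eq_div_iff (hne i), hw0, hws]
    ring
  · have hε' := (isIdx_comp ε π).not.mpr hε
    simp [_root_.extendIdx, hε, hε']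

/-- The identity for the weight functions, with the lengths of the tuples as free parameters. -/
lemma weight_sum_identity (N m n ℓ l : ℕ) (hN : 1 < N) (hl : ℓ = l + 1) (ℏ : ℂ)
    (H : IdxT N m ℓ → (Fin ℓ → ℂ) → ℂ)
    (h1 : PHRel1 N m ℓ ℏ H) (h2 : PHRel2 N m ℓ ℏ H)
    (J' : Fin n → Fin N) (E1 : Fin n → Fin ℓ → Fin n) (Eps : Fin n → IdxT N m ℓ)
    (hE : ∀ a, (J' a : ℕ) = 0 →
      EnumOf (E1 a)
        {r | ((Function.update J' a ⟨1, hN⟩ : Fin n → Fin N) r : ℕ) ≠ 0} ∧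
      (Eps a).1 = fun b =>
        ((Function.update J' a ⟨1, hN⟩ : Fin n → Fin N) (E1 a b) : ℕ) - 1)
    (e : Fin l → Fin n) (he : EnumOf e {r | (J' r : ℕ) ≠ 0})
    (ε : IdxT N m ℓ)
    (hε : ε.1 = fun i : Fin ℓ =>
      if h : (i : ℕ) = 0 then 0
      else (J' (e ⟨(i : ℕ) - 1, by have := i.isLt; omega⟩) : ℕ) - 1)
    (α : Fin ℓ → ℂ) (β : Fin n → ℂ)
    (hα : GenPt ℏ α) (hαβ : ∀ a j, ∀ k : ℤ, α a - β j ≠ (k : ℂ) * ℏ) :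
    ℏ * ∑ a ∈ Finset.univ.filter fun a => (J' a : ℕ) = 0,
        ∑ σ : Equiv.Perm (Fin ℓ), ((Equiv.Perm.sign σ : ℤ) : ℂ) *
          (gfun ℏ (E1 a) (α ∘ σ) β * H (Eps a) (α ∘ σ)) =
      ∑ σ : Equiv.Perm (Fin ℓ), ((Equiv.Perm.sign σ : ℤ) : ℂ) *
        (gfun ℏ e (fun a => (α ∘ σ) ⟨(a : ℕ) + 1, by have := a.isLt; omega⟩) β *
          ((∏ a ∈ Finset.univ.filter fun a : Fin ℓ => 0 < (a : ℕ),
              ((α ∘ σ) ⟨0, by omega⟩ - (α ∘ σ) a - ℏ)) *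
              H ε (α ∘ σ) -
            (∏ j : Fin n,
                (((α ∘ σ) ⟨0, by omega⟩ - β j - ℏ) / ((α ∘ σ) ⟨0, by omega⟩ - β j))) *
              (∏ a ∈ Finset.univ.filter fun a : Fin ℓ => 0 < (a : ℕ),
                ((α ∘ σ) ⟨0, by omega⟩ - (α ∘ σ) a + ((N : ℂ) - 1) * ℏ)) *
              H ε (Function.update (α ∘ σ) ⟨0, by omega⟩
                ((α ∘ σ) ⟨0, by omega⟩ + (N : ℂ) * ℏ)))) := by
  subst hl
  have hα' : ∀ i j, i ≠ j → α i - α j + ℏ ≠ 0 := fun i j hij h =>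
    hα i j hij (-1) (by push_cast; linear_combination h)
  have hαβ' : ∀ i j, α i - β j ≠ 0 := fun i j h => hαβ i j 0 (by simpa using h)
  have hfilter : ∀ f : Fin (l + 1) → ℂ,
      ∏ a ∈ Finset.univ.filter (fun a : Fin (l + 1) => 0 < (a : ℕ)), f a =
        ∏ i : Fin l, f i.succ := fun f => by
    rw [Finset.prod_filter, Fin.prod_univ_succ]
    simp
  have hK : ∀ s ∈ Finset.univ.filter (fun a => (J' a : ℕ) = 0), ∃ p : Fin (l + 1),
      StrictMono (E1 s) ∧ E1 s p = s ∧ E1 s ∘ p.succAbove = e ∧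
        (Eps s).1 = ε.1 ∘ p.cycleRange := by
    intro s hs
    have hs0 : (J' s : ℕ) = 0 := (Finset.mem_filter.mp hs).2
    obtain ⟨⟨hmono, hran⟩, hEps⟩ := hE s hs0
    have hran' : ∀ r, (r = s ∨ (J' r : ℕ) ≠ 0) ↔ ∃ a, E1 s a = r := by
      intro r
      rw [← hran]
      rcases eq_or_ne r s with rfl | hr
      · simp
      · simp [hr]
    obtain ⟨p, hp⟩ := (hran' s).mp (Or.inl rfl)
    have hsa : E1 s ∘ p.succAbove = e := by
      refine ((hmono.comp p.strictMono_succAbove).range_inj he.1).mp ?_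
      ext r
      rw [Set.mem_range, Set.mem_range, ← he.2]
      constructor
      · rintro ⟨i, rfl⟩
        refine ((hran' _).mpr ⟨_, rfl⟩).resolve_left fun h => Fin.succAbove_ne p i ?_
        exact hmono.injective (h.trans hp.symm)
      · intro hr
        obtain ⟨a, rfl⟩ := (hran' r).mp (Or.inr hr)
        have hap : a ≠ p := by
          rintro rfl
          exact hr (by rw [hp]; exact hs0)
        obtain ⟨i, rfl⟩ := Fin.exists_succAbove_eq hap
        exact ⟨i, rfl⟩
    refine ⟨p, hmono, hp, hsa, ?_⟩
    ext b
    rw [hEps, hε]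
    rcases Fin.eq_self_or_eq_succAbove p b with rfl | ⟨i, rfl⟩
    · simp [hp]
    · have hi : E1 s (p.succAbove i) = e i := congrFun hsa i
      have hne : e i ≠ s := by
        rintro h
        exact (he.2 (e i)).mpr ⟨i, rfl⟩ (h ▸ hs0)
      simp [hi, hne]
  have key := sum_insert_eq (F := extendIdx H) (fun ε p q hpq v hv => h1.extendIdx ε p q hpq v hv)
    ε.1 e he.1 β E1 (fun s => (Eps s).1) (Finset.univ.filter fun a => (J' a : ℕ) = 0)
    (fun s hs => (he.2 s).mp (by simpa using hs)) hK α hα' hαβ'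
  simp only [extendIdx_coe] at key
  rw [key]
  refine Finset.sum_congr rfl fun σ _ => ?_
  set u := α ∘ σ
  have hu' : ∀ i : Fin l, u 0 - u i.succ + ℏ ≠ 0 := fun i =>
    hα' _ _ (σ.injective.ne (Fin.succ_ne_zero i).symm)
  have hr := h2.extendIdx ε.1 u hu'
  rw [extendIdx_coe] at hr
  rw [hfilter, hfilter, interp, interp, shiftProd_zero, shiftProd_top]
  simp only [Fin.not_lt_zero, if_false, Fin.castSucc_lt_last, if_true, Fin.cycleRange_zero,
    Equiv.Perm.coe_one, Function.comp_id, extendIdx_coe]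
  change _ = _ * (gfun ℏ e (u ∘ Fin.succ) β * (_ * _ -
    (∏ j : Fin n, (u 0 - β j - ℏ) / (u 0 - β j)) *
      (∏ i : Fin l, (u 0 - u i.succ + ((N : ℂ) - 1) * ℏ)) *
      H ε (Function.update u 0 (u 0 + N * ℏ))))
  change _ = _ * (_ * ((∏ i : Fin l, (u 0 - u i.succ - ℏ)) * _ - _))
  linear_combination (((Equiv.Perm.sign σ : ℤ) : ℂ) * gfun ℏ e (u ∘ Fin.succ) β *
    ∏ j : Fin n, (u 0 - β j - ℏ) / (u 0 - β j)) * hr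

/-- Lemma `simplehw`.  Set `ℓ = (N−1)m`, `n = Nm`.  For
`J' ∈ Z_{ℓ−1,(N−2)m,…,2m,m}` one has the identity
`ℏ·Σ_{a : J'_a=0} w_{(J'₁,…,J'_a+1,…,J'_n)} = Skew( g_{M₁^{J'}}(α₂,…,α_ℓ|β)·{
  ∏_{a=2}^{ℓ}(α₁−α_a−ℏ)·H(α₁) −
  ∏_{j=1}^{n}(α₁−β_j−ℏ)/(α₁−β_j)·∏_{a=2}^{ℓ}(α₁−α_a+(N−1)ℏ)·H(α₁+Nℏ) })`,
where `w_J = Skew(g_{M₁^J}(α|β)·H_{J̄}(α))` and `H(x) = H_{0,J̄'₁,…,J̄'_{ℓ−1}}(x,α₂,…,α_ℓ)`.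
The enumeration of the nonzero entries of each modified tuple `Function.update J' a 1`
is `E1 a`, its reduced index tuple (nonzero entries minus one) is `Eps a`; `e1'` and
`ε'` are the corresponding data for `J'` itself.  The identity of rational functions
is stated pointwise at generic points, the family `{H_ε}` being given pointwise and
satisfying (rel1) and (rel2). -/
theorem statement4 (N m : ℕ) (hN : 2 ≤ N) (hm : 1 ≤ m) (ℏ : ℂ) (hℏ : ℏ ≠ 0)
    (H : IdxT N m ((N - 1) * m) → (Fin ((N - 1) * m) → ℂ) → ℂ)
    (h1 : PHRel1 N m ((N - 1) * m) ℏ H) (h2 : PHRel2 N m ((N - 1) * m) ℏ H)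
    (J' : Fin (N * m) → Fin N)
    (hJ'1 : (Finset.univ.filter fun r => (J' r : ℕ) ≠ 0).card = (N - 1) * m - 1)
    (hJ'j : ∀ j, 2 ≤ j → j ≤ N - 1 →
      (Finset.univ.filter fun r => j ≤ (J' r : ℕ)).card = (N - j) * m)
    (E1 : Fin (N * m) → Fin ((N - 1) * m) → Fin (N * m))
    (Eps : Fin (N * m) → IdxT N m ((N - 1) * m))
    (hE : ∀ a, (J' a : ℕ) = 0 →
      EnumOf (E1 a)
        {r | ((Function.update J' a ⟨1, by omega⟩ : Fin (N * m) → Fin N) r : ℕ) ≠ 0} ∧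
      (Eps a).1 = fun b =>
        ((Function.update J' a ⟨1, by omega⟩ : Fin (N * m) → Fin N) (E1 a b) : ℕ) - 1)
    (e1' : Fin ((N - 1) * m - 1) → Fin (N * m))
    (he1' : EnumOf e1' {r | (J' r : ℕ) ≠ 0})
    (ε' : IdxT N m ((N - 1) * m))
    (hε' : ε'.1 = fun i : Fin ((N - 1) * m) =>
      if h : (i : ℕ) = 0 then 0
      else (J' (e1' ⟨(i : ℕ) - 1, by have := i.isLt; omega⟩) : ℕ) - 1)
    (α : Fin ((N - 1) * m) → ℂ) (β : Fin (N * m) → ℂ)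
    (hα : GenPt ℏ α) (hαβ : ∀ a j, ∀ k : ℤ, α a - β j ≠ (k : ℂ) * ℏ) :
    ℏ * ∑ a ∈ Finset.univ.filter fun a => (J' a : ℕ) = 0,
        ∑ σ : Equiv.Perm (Fin ((N - 1) * m)), ((Equiv.Perm.sign σ : ℤ) : ℂ) *
          (gfun ℏ (E1 a) (α ∘ σ) β * H (Eps a) (α ∘ σ)) =
      ∑ σ : Equiv.Perm (Fin ((N - 1) * m)), ((Equiv.Perm.sign σ : ℤ) : ℂ) *
        (gfun ℏ e1' (fun a => (α ∘ σ) ⟨(a : ℕ) + 1, by have := a.isLt; omega⟩) β *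
          ((∏ a ∈ Finset.univ.filter fun a : Fin ((N - 1) * m) => 0 < (a : ℕ),
              ((α ∘ σ) ⟨0, Nat.mul_pos (by omega) hm⟩ - (α ∘ σ) a - ℏ)) *
              H ε' (α ∘ σ) -
            (∏ j : Fin (N * m),
                (((α ∘ σ) ⟨0, Nat.mul_pos (by omega) hm⟩ - β j - ℏ) /
                  ((α ∘ σ) ⟨0, Nat.mul_pos (by omega) hm⟩ - β j))) *
              (∏ a ∈ Finset.univ.filter fun a : Fin ((N - 1) * m) => 0 < (a : ℕ),
                ((α ∘ σ) ⟨0, Nat.mul_pos (by omega) hm⟩ - (α ∘ σ) a + ((N : ℂ) - 1) * ℏ)) *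
              H ε' (Function.update (α ∘ σ) ⟨0, Nat.mul_pos (by omega) hm⟩
                ((α ∘ σ) ⟨0, Nat.mul_pos (by omega) hm⟩ + (N : ℂ) * ℏ)))) := by
  have hpos : 0 < (N - 1) * m := Nat.mul_pos (by omega) hm
  exact weight_sum_identity N m _ _ _ (by omega) (by omega) ℏ H h1 h2 J' E1 Eps hE e1' he1' ε'
    hε' α β hα hαβ

end
end
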